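/- Let {c_n} be a sequence of positive numbers and {X_{n,j}, 1 ≤ j ≤ k_n, n ≥ 1} be an array of random variables satisfying the exponential-type maximal inequality (2.1) with nonnegative sequences {α_n}, {β_n} such that α_n = O(1) and β_n = O(1) as n → ∞. Assume (i') for all λ > 0, ∑_{n=1}^∞ c_n ∑_{j=1}^{k_n} P{|X_{n,j}| > λ} < ∞, and (ii') there exist δ > 0 and q ≥ 1 such that ∑_{n=1}^∞ c_n (∑_{j=1}^{k_n} Var(X_{n,j} 1_{{|X_{n,j}| ≤ δ}}))^q < ∞. Then for all ε > 0, ∑_{n=1}^∞ c_n P{max_{1≤i≤k_n} |∑_{j=1}^i (X_{n,j} − E[X_{n,j} 1_{{|X_{n,j}| ≤ δ}}])| > ε} < ∞. -/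

import Mathlib

open MeasureTheory Finset

/-- Truncation at level `ℓ`: `g_ℓ(x) = (x ∧ ℓ) ∨ (-ℓ)`. -/
noncomputable def truncAt (l x : ℝ) : ℝ := max (min x l) (-l)

/-- The exponential-type maximal inequality (2.1) for the array `X` with row lengths `k`
and nonnegative sequences `α`, `β`: there are constants `C₁, C₂ > 0`, not depending on
`n, ℓ, λ, η`, such that for every `n ≥ 1` and all `ℓ, λ, η > 0`,
`P{max_{1≤i≤kₙ} |∑_{j=1}^i [g_ℓ(X_{n,j}) − E g_ℓ(X_{n,j})]| ≥ λ}
  ≤ αₙ P{max_{1≤j≤kₙ} |g_ℓ(X_{n,j}) − E g_ℓ(X_{n,j})| > C₁ η}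
    + βₙ (∑_{j=1}^{kₙ} E (g_ℓ(X_{n,j}) − E g_ℓ(X_{n,j}))² / (C₂ λ η))^{λ/η}`. -/
def ExpMaxIneq {Ω : Type*} [MeasurableSpace Ω] (μ : Measure Ω)
    (k : ℕ → ℕ) (X : ℕ → ℕ → Ω → ℝ) (α β : ℕ → ℝ) : Prop :=
  ∃ C₁ > (0 : ℝ), ∃ C₂ > (0 : ℝ), ∀ n, 1 ≤ n → ∀ l > (0 : ℝ), ∀ lam > (0 : ℝ), ∀ η > (0 : ℝ),
    μ {ω | ∃ i ∈ Finset.Icc 1 (k n), lam ≤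
        |∑ j ∈ Finset.Icc 1 i, (truncAt l (X n j ω) - ∫ ω', truncAt l (X n j ω') ∂μ)|}
      ≤ ENNReal.ofReal (α n) *
          μ {ω | ∃ j ∈ Finset.Icc 1 (k n),
            C₁ * η < |truncAt l (X n j ω) - ∫ ω', truncAt l (X n j ω') ∂μ|}
        + ENNReal.ofReal (β n) *
          ENNReal.ofReal ((∑ j ∈ Finset.Icc 1 (k n),
              ∫ ω', (truncAt l (X n j ω') - ∫ ω'', truncAt l (X n j ω'') ∂μ) ^ 2 ∂μ) /
            (C₂ * lam * η)) ^ (lam / η)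

lemma abs_truncAt_le {l : ℝ} (hl : 0 < l) (x : ℝ) : |truncAt l x| ≤ l := by
  unfold truncAt
  grind

lemma abs_truncAt_le_abs {l : ℝ} (hl : 0 < l) (x : ℝ) : |truncAt l x| ≤ |x| := by
  unfold truncAt
  grind

lemma truncAt_of_abs_le {l x : ℝ} (h : |x| ≤ l) : truncAt l x = x := by
  unfold truncAt
  grind

lemma measurable_truncAt (l : ℝ) : Measurable (truncAt l) := by
  unfold truncAt
  fun_prop

section Truncation

variable {Ω : Type*} [MeasurableSpace Ω] {μ : Measure Ω} {Y : Ω → ℝ}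

lemma measurableSet_lt_abs (hY : Measurable Y) (t : ℝ) : MeasurableSet {ω | t < |Y ω|} :=
  measurableSet_lt measurable_const hY.abs

lemma integral_ite_lt_abs (hY : Measurable Y) (t l : ℝ) :
    ∫ ω, (if t < |Y ω| then l else 0) ∂μ = l * μ.real {ω | t < |Y ω|} := by
  have h := integral_indicator_const (μ := μ) l (measurableSet_lt_abs hY t)
  rw [smul_eq_mul, mul_comm] at h
  rw [← h]
  rfl

variable [IsProbabilityMeasure μ]

lemma memLp_truncAt (hY : Measurable Y) {l : ℝ} (hl : 0 < l) (p : ENNReal) :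
    MemLp (fun ω => truncAt l (Y ω)) p μ :=
  MemLp.of_bound ((measurable_truncAt l).comp hY).aestronglyMeasurable l
    (ae_of_all _ fun ω => abs_truncAt_le hl (Y ω))

lemma memLp_cutoff (hY : Measurable Y) {l : ℝ} (hl : 0 < l) (p : ENNReal) :
    MemLp (fun ω => if |Y ω| ≤ l then Y ω else 0) p μ := by
  refine MemLp.of_bound (Measurable.ite (measurableSet_le hY.abs measurable_const) hY
    measurable_const).aestronglyMeasurable l (ae_of_all _ fun ω => ?_)
  rw [Real.norm_eq_abs]
  split_ifs with h
  · exact h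
  · simpa using hl.le

lemma abs_truncAt_sub_cutoff_le {l : ℝ} (hl : 0 < l) (x : ℝ) :
    |truncAt l x - if |x| ≤ l then x else 0| ≤ if l < |x| then l else 0 := by
  by_cases h : |x| ≤ l
  · simp [h, truncAt_of_abs_le h, not_lt.mpr h]
  · simpa [h, not_le.mp h] using abs_truncAt_le hl x

lemma integrable_ite_lt_abs (hY : Measurable Y) (t l : ℝ) :
    Integrable (fun ω => if t < |Y ω| then l else 0) μ :=
  (integrable_const l).indicator (measurableSet_lt_abs hY t)

lemma abs_integral_truncAt_sub_integral_cutoff_le (hY : Measurable Y) {l : ℝ} (hl : 0 < l) :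
    |∫ ω, truncAt l (Y ω) ∂μ - ∫ ω, (if |Y ω| ≤ l then Y ω else 0) ∂μ|
      ≤ l * μ.real {ω | l < |Y ω|} := by
  rw [← integral_sub ((memLp_truncAt hY hl 1).integrable le_rfl)
    ((memLp_cutoff hY hl 1).integrable le_rfl), ← integral_ite_lt_abs hY]
  rw [← Real.norm_eq_abs]
  exact norm_integral_le_of_norm_le (integrable_ite_lt_abs hY l l)
    (ae_of_all _ fun ω => abs_truncAt_sub_cutoff_le hl (Y ω))

lemma abs_integral_truncAt_le (hY : Measurable Y) {l t : ℝ} (hl : 0 < l) (ht : 0 < t) :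
    |∫ ω, truncAt l (Y ω) ∂μ| ≤ t + l * μ.real {ω | t < |Y ω|} := by
  have hint := integrable_ite_lt_abs (μ := μ) hY t l
  have h : ∫ ω, (t + if t < |Y ω| then l else 0) ∂μ = t + l * μ.real {ω | t < |Y ω|} := by
    rw [integral_add (integrable_const t) hint, integral_ite_lt_abs hY]
    simp
  rw [← h, ← Real.norm_eq_abs]
  refine norm_integral_le_of_norm_le ((integrable_const t).add hint) (ae_of_all _ fun ω => ?_)
  have h1 := abs_truncAt_le hl (Y ω)
  have h2 := abs_truncAt_le_abs hl (Y ω)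
  rw [Real.norm_eq_abs]
  split_ifs <;> linarith

lemma variance_add_le_two_mul {U V : Ω → ℝ} (hU : MemLp U 2 μ) (hV : MemLp V 2 μ) :
    ProbabilityTheory.variance (U + V) μ
      ≤ 2 * ProbabilityTheory.variance U μ + 2 * ProbabilityTheory.variance V μ := by
  have h1 := ProbabilityTheory.variance_add hU hV
  have h2 := ProbabilityTheory.variance_sub hU hV
  have h3 := ProbabilityTheory.variance_nonneg (U - V) μ
  linarith

lemma integral_sq_truncAt_sub_le (hY : Measurable Y) {l : ℝ} (hl : 0 < l) :
    ∫ ω, (truncAt l (Y ω) - ∫ ω', truncAt l (Y ω') ∂μ) ^ 2 ∂μ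
      ≤ 2 * ProbabilityTheory.variance (fun ω => if |Y ω| ≤ l then Y ω else 0) μ
        + 2 * l ^ 2 * μ.real {ω | l < |Y ω|} := by
  have hg := memLp_truncAt (μ := μ) hY hl 2
  have hu := memLp_cutoff (μ := μ) hY hl 2
  have hr := hg.sub hu
  have h1 := variance_add_le_two_mul hu hr
  rw [add_sub_cancel, ProbabilityTheory.variance_eq_integral hg.aemeasurable] at h1
  have h2 := ProbabilityTheory.variance_le_expectation_sq hr.aestronglyMeasurable
  have h3 : ∫ ω, (((fun ω => truncAt l (Y ω)) - fun ω => if |Y ω| ≤ l then Y ω else 0) ^ 2) ω ∂μ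
      ≤ l ^ 2 * μ.real {ω | l < |Y ω|} := by
    rw [← integral_ite_lt_abs hY]
    refine integral_mono hr.integrable_sq (integrable_ite_lt_abs hY l (l ^ 2)) fun ω => ?_
    have h := abs_truncAt_sub_cutoff_le hl (Y ω)
    simp only [Pi.pow_apply, Pi.sub_apply]
    rw [← sq_abs]
    refine (pow_le_pow_left₀ (abs_nonneg _) h 2).trans (le_of_eq ?_)
    split_ifs <;> simp
  linarith

end Truncation

section Row

variable {Ω : Type*} [MeasurableSpace Ω] {μ : Measure Ω}
  {m : ℕ} {Y : ℕ → Ω → ℝ}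

lemma measureReal_exists_lt_abs_le (t : ℝ) :
    μ.real {ω | ∃ j ∈ Finset.Icc 1 m, t < |Y j ω|}
      ≤ ∑ j ∈ Finset.Icc 1 m, μ.real {ω | t < |Y j ω|} := by
  have h : {ω | ∃ j ∈ Finset.Icc 1 m, t < |Y j ω|}
      = ⋃ j ∈ Finset.Icc 1 m, {ω | t < |Y j ω|} := by
    ext ω
    simp
  rw [h]
  exact measureReal_biUnion_finset_le _ _

variable [IsProbabilityMeasure μ]

lemma measureReal_centered_truncAt_le (hY : ∀ j ∈ Finset.Icc 1 m, Measurable (Y j))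
    {l t : ℝ} (hl : 0 < l) (ht : 0 < t)
    (hsmall : l * ∑ j ∈ Finset.Icc 1 m, μ.real {ω | t < |Y j ω|} ≤ t) :
    μ.real {ω | ∃ j ∈ Finset.Icc 1 m,
        4 * t < |truncAt l (Y j ω) - ∫ ω', truncAt l (Y j ω') ∂μ|}
      ≤ ∑ j ∈ Finset.Icc 1 m, μ.real {ω | t < |Y j ω|} := by
  refine (measureReal_mono ?_).trans (measureReal_exists_lt_abs_le t)
  rintro ω ⟨j, hj, h⟩
  refine ⟨j, hj, ?_⟩
  have h1 := abs_integral_truncAt_le (μ := μ) (hY j hj) hl ht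
  have h2 : l * μ.real {ω | t < |Y j ω|} ≤ t :=
    (mul_le_mul_of_nonneg_left (Finset.single_le_sum
      (f := fun j => μ.real {ω | t < |Y j ω|}) (fun _ _ => measureReal_nonneg) hj) hl.le).trans
      hsmall
  have h3 := abs_truncAt_le_abs hl (Y j ω)
  have h4 := abs_sub (truncAt l (Y j ω)) (∫ ω', truncAt l (Y j ω') ∂μ)
  linarith

lemma measureReal_partialSum_le (hY : ∀ j ∈ Finset.Icc 1 m, Measurable (Y j))
    {l ε : ℝ} (hl : 0 < l)
    (hsmall : l * ∑ j ∈ Finset.Icc 1 m, μ.real {ω | l < |Y j ω|} ≤ ε / 2) :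
    μ.real {ω | ∃ i ∈ Finset.Icc 1 m, ε < |∑ j ∈ Finset.Icc 1 i,
        (Y j ω - ∫ ω', (if |Y j ω'| ≤ l then Y j ω' else 0) ∂μ)|}
      ≤ ∑ j ∈ Finset.Icc 1 m, μ.real {ω | l < |Y j ω|}
        + μ.real {ω | ∃ i ∈ Finset.Icc 1 m, ε / 2 ≤ |∑ j ∈ Finset.Icc 1 i,
            (truncAt l (Y j ω) - ∫ ω', truncAt l (Y j ω') ∂μ)|} := by
  refine (measureReal_mono (s₂ := {ω | ∃ j ∈ Finset.Icc 1 m, l < |Y j ω|} ∪ _) ?_).trans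
    ((measureReal_union_le _ _).trans
      (add_le_add_left (measureReal_exists_lt_abs_le l) _))
  rintro ω ⟨i, hi, h⟩
  by_cases hω : ∃ j ∈ Finset.Icc 1 m, l < |Y j ω|
  · exact Or.inl hω
  refine Or.inr ⟨i, hi, ?_⟩
  push Not at hω
  have hsub : Finset.Icc 1 i ⊆ Finset.Icc 1 m :=
    Finset.Icc_subset_Icc_right (Finset.mem_Icc.mp hi).2
  have hsplit : ∑ j ∈ Finset.Icc 1 i,
        (Y j ω - ∫ ω', (if |Y j ω'| ≤ l then Y j ω' else 0) ∂μ)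
      = ∑ j ∈ Finset.Icc 1 i, (truncAt l (Y j ω) - ∫ ω', truncAt l (Y j ω') ∂μ)
        + ∑ j ∈ Finset.Icc 1 i, (∫ ω', truncAt l (Y j ω') ∂μ
            - ∫ ω', (if |Y j ω'| ≤ l then Y j ω' else 0) ∂μ) := by
    rw [← Finset.sum_add_distrib]
    refine Finset.sum_congr rfl fun j hj => ?_
    rw [truncAt_of_abs_le (hω j (hsub hj))]
    ring
  have hbias : |∑ j ∈ Finset.Icc 1 i, (∫ ω', truncAt l (Y j ω') ∂μ
      - ∫ ω', (if |Y j ω'| ≤ l then Y j ω' else 0) ∂μ)| ≤ ε / 2 := by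
    refine (Finset.abs_sum_le_sum_abs _ _).trans (le_trans ?_ hsmall)
    rw [Finset.mul_sum]
    refine (Finset.sum_le_sum fun j hj =>
      abs_integral_truncAt_sub_integral_cutoff_le (hY j (hsub hj)) hl).trans ?_
    exact Finset.sum_le_sum_of_subset_of_nonneg hsub fun j _ _ => by positivity
  rw [hsplit] at h
  have := abs_add_le (∑ j ∈ Finset.Icc 1 i, (truncAt l (Y j ω) - ∫ ω', truncAt l (Y j ω') ∂μ))
    (∑ j ∈ Finset.Icc 1 i, (∫ ω', truncAt l (Y j ω') ∂μ
            - ∫ ω', (if |Y j ω'| ≤ l then Y j ω' else 0) ∂μ))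
  linarith

lemma sum_integral_sq_truncAt_sub_le (hY : ∀ j ∈ Finset.Icc 1 m, Measurable (Y j))
    {l : ℝ} (hl : 0 < l) :
    ∑ j ∈ Finset.Icc 1 m, ∫ ω, (truncAt l (Y j ω) - ∫ ω', truncAt l (Y j ω') ∂μ) ^ 2 ∂μ
      ≤ 2 * ∑ j ∈ Finset.Icc 1 m,
            ProbabilityTheory.variance (fun ω => if |Y j ω| ≤ l then Y j ω else 0) μ
        + 2 * l ^ 2 * ∑ j ∈ Finset.Icc 1 m, μ.real {ω | l < |Y j ω|} := by
  rw [Finset.mul_sum, Finset.mul_sum, ← Finset.sum_add_distrib]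
  exact Finset.sum_le_sum fun j hj => integral_sq_truncAt_sub_le (hY j hj) hl

end Row

lemma rpow_add_le_two_rpow_mul {x y q : ℝ} (hx : 0 ≤ x) (hy : 0 ≤ y) (hq : 0 ≤ q) :
    (x + y) ^ q ≤ 2 ^ q * (x ^ q + y ^ q) := by
  have hmax : x + y ≤ 2 * max x y := by
    linarith [le_max_left x y, le_max_right x y]
  calc (x + y) ^ q ≤ (2 * max x y) ^ q := Real.rpow_le_rpow (by positivity) hmax hq
    _ = 2 ^ q * max x y ^ q := Real.mul_rpow (by norm_num) (by positivity)
    _ ≤ 2 ^ q * (x ^ q + y ^ q) := by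
      gcongr
      rcases max_choice x y with h | h <;> rw [h] <;>
        linarith [Real.rpow_nonneg hx q, Real.rpow_nonneg hy q]

lemma rpow_two_mul_add_div_le {W A q s D : ℝ} (hW : 0 ≤ W) (hA : 0 ≤ A) (hA1 : A ≤ 1)
    (hq : 1 ≤ q) (hs : 0 ≤ s) (hD : 0 < D) :
    ((2 * W + s * A) / D) ^ q ≤ 2 ^ q * ((2 / D) ^ q * W ^ q + (s / D) ^ q * A) := by
  have hq0 : 0 ≤ q := zero_le_one.trans hq
  have h : (2 * W + s * A) / D = 2 / D * W + s / D * A := by ring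
  rw [h]
  refine (rpow_add_le_two_rpow_mul (by positivity) (by positivity) hq0).trans ?_
  rw [Real.mul_rpow (by positivity) hW, Real.mul_rpow (by positivity) hA]
  have hAq : A ^ q ≤ A := by
    simpa using Real.rpow_le_rpow_of_exponent_ge' hA hA1 zero_le_one hq
  gcongr

/-- Theorem 2: the same conclusion under `αₙ = O(1) = βₙ` and the weaker assumptions
(i') and (ii'). -/
theorem theorem2 {Ω : Type*} [MeasurableSpace Ω] (μ : Measure Ω) [IsProbabilityMeasure μ]
    (k : ℕ → ℕ) (hk1 : ∀ n, 1 ≤ k n) (hk : Filter.Tendsto k Filter.atTop Filter.atTop)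
    (X : ℕ → ℕ → Ω → ℝ) (hmeas : ∀ n j, j ∈ Finset.Icc 1 (k n) → Measurable (X n j))
    (c α β : ℕ → ℝ) (hc : ∀ n, 0 < c n) (hα : ∀ n, 0 ≤ α n) (hβ : ∀ n, 0 ≤ β n)
    (hαO : α =O[Filter.atTop] (fun _ => (1 : ℝ)))
    (hβO : β =O[Filter.atTop] (fun _ => (1 : ℝ)))
    (hineq : ExpMaxIneq μ k X α β)
    -- (i')
    (hi : ∀ lam > (0 : ℝ),
      (∑' n, ENNReal.ofReal (c n) *
        ∑ j ∈ Finset.Icc 1 (k n), μ {ω | lam < |X n j ω|}) < ⊤)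
    -- (ii')
    (δ : ℝ) (hδ : 0 < δ) (q : ℝ) (hq : 1 ≤ q)
    (hii : (∑' n, ENNReal.ofReal (c n *
        (∑ j ∈ Finset.Icc 1 (k n),
          ProbabilityTheory.variance (fun ω => if |X n j ω| ≤ δ then X n j ω else 0) μ) ^ q))
      < ⊤) :
    ∀ ε > (0 : ℝ),
      (∑' n, ENNReal.ofReal (c n) *
        μ {ω | ∃ i ∈ Finset.Icc 1 (k n), ε <
          |∑ j ∈ Finset.Icc 1 i,
            (X n j ω - ∫ ω', (if |X n j ω'| ≤ δ then X n j ω' else 0) ∂μ)|}) < ⊤ := by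
  intro ε hε
  obtain ⟨C₁, hC₁, C₂, hC₂, hineq⟩ := hineq
  obtain ⟨B, hB0, hB⟩ := hαO.exists_nonneg
  obtain ⟨B', hB'0, hB'⟩ := hβO.exists_nonneg
  obtain ⟨N, hN⟩ := Filter.eventually_atTop.mp
    ((hB.bound.and hB'.bound).and (Filter.eventually_ge_atTop 1))
  have hq0 : 0 < q := zero_lt_one.trans_le hq
  set lam : ℝ := ε / 2
  have hlam0 : 0 < lam := by positivity
  set η : ℝ := lam / q with hη
  have hη0 : 0 < η := by positivity
  set t : ℝ := C₁ * η / 4 with ht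
  have ht0 : 0 < t := by positivity
  have hlamη : lam / η = q := by
    rw [hη]
    field_simp
  set A : ℝ → ℕ → ℝ := fun l n => ∑ j ∈ Finset.Icc 1 (k n), μ.real {ω | l < |X n j ω|}
  have hA0 : ∀ l n, 0 ≤ A l n := fun l n => Finset.sum_nonneg fun _ _ => measureReal_nonneg
  set W : ℕ → ℝ := fun n => ∑ j ∈ Finset.Icc 1 (k n),
    ProbabilityTheory.variance (fun ω => if |X n j ω| ≤ δ then X n j ω else 0) μ
  have hW0 : ∀ n, 0 ≤ W n := fun n =>
    Finset.sum_nonneg fun _ _ => ProbabilityTheory.variance_nonneg _ _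
  set S : ℕ → Set Ω := fun n => {ω | ∃ i ∈ Finset.Icc 1 (k n), ε <
    |∑ j ∈ Finset.Icc 1 i, (X n j ω - ∫ ω', (if |X n j ω'| ≤ δ then X n j ω' else 0) ∂μ)|}
  have hsumA : ∀ l > 0, ∑' n, ENNReal.ofReal (c n * A l n) < ⊤ := by
    intro l hl
    refine lt_of_eq_of_lt (tsum_congr fun n => ?_) (hi l hl)
    rw [ENNReal.ofReal_mul (hc n).le, ENNReal.ofReal_sum_of_nonneg fun _ _ => measureReal_nonneg]
    exact congrArg _ (Finset.sum_congr rfl fun _ _ => ofReal_measureReal)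
  set D : ℝ := C₂ * lam * η
  have hD0 : 0 < D := by positivity
  obtain ⟨θ, hθ0, hθ1, hθδ, hθt⟩ : ∃ θ > 0, θ ≤ 1 ∧ δ * θ ≤ ε / 2 ∧ δ * θ ≤ t := by
    refine ⟨min 1 (min (ε / 2 / δ) (t / δ)), by positivity, min_le_left _ _, ?_, ?_⟩
    · rw [mul_comm, ← le_div_iff₀ hδ]
      exact (min_le_right _ _).trans (min_le_left _ _)
    · rw [mul_comm, ← le_div_iff₀ hδ]
      exact (min_le_right _ _).trans (min_le_right _ _)
  obtain ⟨K, hK0, hK⟩ : ∃ K, 0 ≤ K ∧ ∀ n ≥ N,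
      μ.real (S n) ≤ K * (A δ n + A t n + W n ^ q) := by
    set M : ℝ := B' * (2 ^ q * ((2 / D) ^ q + (2 * δ ^ 2 / D) ^ q)) with hM
    have hM0 : 0 ≤ M := by positivity
    refine ⟨1 / θ + 1 + B + M, by positivity, fun n hn => ?_⟩
    obtain ⟨⟨hαB, hβB⟩, hn1⟩ := hN n hn
    simp only [norm_one, mul_one, Real.norm_eq_abs, abs_of_nonneg (hα n),
      abs_of_nonneg (hβ n)] at hαB hβB
    have hAδ := hA0 δ n
    have hAt := hA0 t n
    have hWn := hW0 n
    have hWq : 0 ≤ W n ^ q := Real.rpow_nonneg hWn q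
    rcases le_or_gt θ (A δ n + A t n) with hbig | hsmall
    · have h1 : μ.real (S n) ≤ 1 := measureReal_le_one
      have h2 : 1 ≤ 1 / θ * (A δ n + A t n) := by
        rw [one_div, ← div_eq_inv_mul, one_le_div hθ0]
        exact hbig
      have h3 : 0 ≤ 1 / θ * W n ^ q := by positivity
      have h4 : 0 ≤ (1 + B + M) * (A δ n + A t n + W n ^ q) := by positivity
      linarith
    · have hsδ : δ * A δ n ≤ ε / 2 :=
        (mul_le_mul_of_nonneg_left (by linarith) hδ.le).trans hθδ
      have hst : δ * A t n ≤ t :=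
        (mul_le_mul_of_nonneg_left (by linarith) hδ.le).trans hθt
      have h1 := measureReal_partialSum_le (μ := μ) (hmeas n) hδ hsδ
      have h2 := measureReal_centered_truncAt_le (μ := μ) (hmeas n) hδ ht0 hst
      have h3 := sum_integral_sq_truncAt_sub_le (μ := μ) (hmeas n) hδ
      have hm := hineq n hn1 δ hδ lam hlam0 η hη0
      have hV0 : 0 ≤ ∑ j ∈ Finset.Icc 1 (k n),
          ∫ ω', (truncAt δ (X n j ω') - ∫ ω'', truncAt δ (X n j ω'') ∂μ) ^ 2 ∂μ :=
        Finset.sum_nonneg fun _ _ => integral_nonneg fun _ => sq_nonneg _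
      rw [hlamη, ENNReal.ofReal_rpow_of_nonneg (div_nonneg hV0 hD0.le) hq0.le,
        ← ofReal_measureReal, ← ofReal_measureReal, ← ENNReal.ofReal_mul (hα n),
        ← ENNReal.ofReal_mul (hβ n),
        ← ENNReal.ofReal_add (mul_nonneg (hα n) measureReal_nonneg)
          (mul_nonneg (hβ n) (Real.rpow_nonneg (div_nonneg hV0 hD0.le) q)),
        ENNReal.ofReal_le_ofReal_iff (add_nonneg (mul_nonneg (hα n) measureReal_nonneg)
          (mul_nonneg (hβ n) (Real.rpow_nonneg (div_nonneg hV0 hD0.le) q))),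
        show C₁ * η = 4 * t by rw [ht]; ring] at hm
      have h4 := mul_le_mul hαB h2 measureReal_nonneg hB0
      have h5 := (Real.rpow_le_rpow (div_nonneg hV0 hD0.le)
        (div_le_div_of_nonneg_right h3 hD0.le) hq0.le).trans
        (rpow_two_mul_add_div_le hWn hAδ (by linarith) hq (by positivity) hD0)
      have h6 := mul_le_mul hβB h5 (Real.rpow_nonneg (div_nonneg hV0 hD0.le) q) hB'0
      have h7 : B' * (2 ^ q * ((2 / D) ^ q * W n ^ q + (2 * δ ^ 2 / D) ^ q * A δ n))
          ≤ M * (A δ n + W n ^ q) := by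
        have : 0 ≤ B' * 2 ^ q * ((2 / D) ^ q * A δ n + (2 * δ ^ 2 / D) ^ q * W n ^ q) := by
          positivity
        rw [hM]
        linarith
      have h8 : 0 ≤ 1 / θ * (A δ n + A t n + W n ^ q) := by positivity
      have h9 : 0 ≤ B * (A δ n + W n ^ q) := by positivity
      have h10 : 0 ≤ M * A t n := by positivity
      have h11 : μ.real (S n) ≤ A δ n + (B * A t n + M * (A δ n + W n ^ q)) :=
        h1.trans (add_le_add_right (hm.trans (add_le_add h4 (h6.trans h7))) _)
      linarith
  have hterm : ∀ n, ENNReal.ofReal (c n) * μ (S n)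
      ≤ ENNReal.ofReal K * (ENNReal.ofReal (c n * A δ n) + ENNReal.ofReal (c n * A t n)
          + ENNReal.ofReal (c n * W n ^ q))
        + if n ∈ Finset.range N then ENNReal.ofReal (c n) else 0 := by
    intro n
    by_cases hn : n < N
    · rw [if_pos (Finset.mem_range.mpr hn)]
      exact le_add_left (mul_le_of_le_one_right' prob_le_one)
    · rw [if_neg (by simpa using hn), add_zero]
      have hAδ := mul_nonneg (hc n).le (hA0 δ n)
      have hAt := mul_nonneg (hc n).le (hA0 t n)
      have hWq := mul_nonneg (hc n).le (Real.rpow_nonneg (hW0 n) q)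
      rw [← ENNReal.ofReal_add hAδ hAt, ← ENNReal.ofReal_add (add_nonneg hAδ hAt) hWq,
        ← ENNReal.ofReal_mul hK0, ← ofReal_measureReal, ← ENNReal.ofReal_mul (hc n).le]
      refine ENNReal.ofReal_le_ofReal ?_
      refine (mul_le_mul_of_nonneg_left (hK n (not_lt.mp hn)) (hc n).le).trans (le_of_eq ?_)
      ring
  refine (ENNReal.tsum_le_tsum hterm).trans_lt ?_
  rw [ENNReal.tsum_add, ENNReal.tsum_mul_left, ENNReal.tsum_add, ENNReal.tsum_add]
  refine ENNReal.add_lt_top.mpr ⟨ENNReal.mul_lt_top ENNReal.ofReal_lt_top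
    (ENNReal.add_lt_top.mpr ⟨ENNReal.add_lt_top.mpr ⟨hsumA δ hδ, hsumA t ht0⟩, hii⟩), ?_⟩
  rw [tsum_eq_sum (s := Finset.range N) fun n hn => if_neg hn]
  refine ENNReal.sum_lt_top.mpr fun n hn => ?_
  rw [if_pos hn]
  exact ENNReal.ofReal_lt_top
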